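/- Let G and H be loopless weakly connected digraphs, α, β : G → H homomorphisms, q ∈ V(G), and let Q be a reduced walk of even length from α(q) to β(q) that is topologically valid for α, β, q; for each v ∈ V(G) let S_v be the reduced walk α(W_v)⁻¹ · Q · β(W_v) for a walk W_v from q to v. Then: (1) if G has no vertex of type SYM and Q satisfies the zigzag condition for q, then S_v satisfies the zigzag condition for v for every v ∈ V(G); (2) if the set of vertices of G of type SYM is nonempty and S_w satisfies the zigzag condition for w for every vertex w of type SYM, then S_v satisfies the zigzag condition for v for every v ∈ V(G). -/

import Mathlib

namespace HRecoloring

/-- A digraph: a vertex type together with an arc relation. -/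
structure Dgraph (V : Type) where
  Adj : V → V → Prop

variable {V X : Type}

/-- Adjacency in the underlying undirected graph. -/
def Dgraph.UAdj (G : Dgraph V) (u v : V) : Prop := G.Adj u v ∨ G.Adj v u

/-- A digraph is loopless if it has no arc `v → v`. -/
def Dgraph.Loopless (G : Dgraph V) : Prop := ∀ v, ¬ G.Adj v v

/-- A digraph is reflexive if `v → v` for every vertex `v`. -/
def Dgraph.IsReflexive (G : Dgraph V) : Prop := ∀ v, G.Adj v v

/-- A symmetric digraph, which we identify with an undirected graph. -/
def Dgraph.IsSymmetric (G : Dgraph V) : Prop := ∀ u v, G.Adj u v → G.Adj v u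

/-- The underlying undirected graph, as a symmetric digraph. -/
def Dgraph.usym (G : Dgraph V) : Dgraph V := ⟨fun u v => G.UAdj u v⟩

/-- A (di)graph homomorphism. -/
def IsHom (G : Dgraph V) (H : Dgraph X) (f : V → X) : Prop :=
  ∀ ⦃u v⦄, G.Adj u v → H.Adj (f u) (f v)

/-- A walk from `a` to `b`, encoded by its list of successive vertices.
A walk in a digraph is a walk in its underlying undirected graph. -/
def IsWalk (G : Dgraph V) (a b : V) (l : List V) : Prop :=
  l ≠ [] ∧ l.head? = some a ∧ l.getLast? = some b ∧ l.Chain' G.UAdj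

/-- Weak connectivity. -/
def Dgraph.WConn (G : Dgraph V) : Prop := ∀ u v : V, ∃ l, IsWalk G u v l

/-- Concatenation of two walks sharing an endpoint. -/
def wcomp (l₁ l₂ : List V) : List V := l₁ ++ l₂.tail

/-- Number of edges of a walk. -/
def wlen (l : List V) : ℕ := l.length - 1

/-- One reduction step on walks: delete a backtracking pair `(x y)(y x)` or a
one-edge loop step `(x x)`. -/
def RStep (l l' : List V) : Prop :=
  (∃ (p s : List V) (x y : V), l = p ++ [x, y, x] ++ s ∧ l' = p ++ [x] ++ s) ∨
  (∃ (p s : List V) (x : V), l = p ++ [x, x] ++ s ∧ l' = p ++ [x] ++ s)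

/-- Equality of walks in the fundamental groupoid `π(H)`: the equivalence
generated by reduction steps (two walks are equal in `π(H)` iff they reduce to
the same reduced walk). -/
def PiEq (l l' : List V) : Prop := Relation.EqvGen RStep l l'

/-- A walk is reduced if no reduction step applies to it. -/
def IsReduced (l : List V) : Prop := ∀ l', ¬ RStep l l'

/-- A closed walk is cyclically reduced if it is reduced and its first and last
edges are not inverses of each other. -/
def IsCycReduced (l : List V) : Prop :=
  IsReduced l ∧ ∃ h : 2 ≤ l.length,
    l.get ⟨1, by omega⟩ ≠ l.get ⟨l.length - 2, by omega⟩

/-- `n`-fold concatenation of a closed walk `R` based at `h`. -/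
def witer (R : List V) (h : V) : ℕ → List V
  | 0 => [h]
  | n + 1 => wcomp R (witer R h n)

/-- `Rⁿ` for an integer `n`, for a closed walk `R` based at `h`; for `n < 0`
this is the `|n|`-fold concatenation of the reversed walk `R⁻¹`. -/
def zpowWalk (R : List V) (h : V) (n : ℤ) : List V :=
  if 0 ≤ n then witer R h n.toNat else witer R.reverse h (-n).toNat

/-- A walk is symmetric if every edge it traverses is a symmetric arc. -/
def IsSymWalk (H : Dgraph X) (l : List X) : Prop :=
  l.Chain' fun a b => H.Adj a b ∧ H.Adj b a

/-- The conjugated walk `α(W)⁻¹ · Q · β(W)`. -/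
def conj (α β : V → X) (Wl : List V) (Q : List X) : List X :=
  wcomp (wcomp (Wl.map α).reverse Q) (Wl.map β)

/-- Topological validity of a walk `Q` from `α q` to `β q`:
`β(C) = Q⁻¹ · α(C) · Q` in `π(H)` for every closed walk `C` at `q`. -/
def TopValid (G : Dgraph V) (H : Dgraph X) (α β : V → X) (q : V) (Q : List X) : Prop :=
  ∀ C : List V, IsWalk G q q C →
    PiEq (C.map β) (wcomp (wcomp Q.reverse (C.map α)) Q)

/-- IN-zigzag pattern `a₁ ← a₂ → a₃ ← … ← a_{n-1} → a_n`. -/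
def INCompatible (H : Dgraph X) (l : List X) : Prop :=
  ∀ (i : ℕ) (h : i + 1 < l.length),
    if i % 2 = 0 then H.Adj (l.get ⟨i + 1, h⟩) (l.get ⟨i, by omega⟩)
    else H.Adj (l.get ⟨i, by omega⟩) (l.get ⟨i + 1, h⟩)

/-- OUT-zigzag pattern `a₁ → a₂ ← a₃ → … → a_{n-1} ← a_n`. -/
def OUTCompatible (H : Dgraph X) (l : List X) : Prop :=
  ∀ (i : ℕ) (h : i + 1 < l.length),
    if i % 2 = 0 then H.Adj (l.get ⟨i, by omega⟩) (l.get ⟨i + 1, h⟩)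
    else H.Adj (l.get ⟨i + 1, h⟩) (l.get ⟨i, by omega⟩)

/-- A vertex is of type IN if it has an in-neighbor. -/
def TypeIN (G : Dgraph V) (v : V) : Prop := ∃ u, G.Adj u v

/-- A vertex is of type OUT if it has an out-neighbor. -/
def TypeOUT (G : Dgraph V) (v : V) : Prop := ∃ u, G.Adj v u

/-- A vertex is of type SYM if it is of type IN and of type OUT. -/
def TypeSYM (G : Dgraph V) (v : V) : Prop := TypeIN G v ∧ TypeOUT G v

/-- The zigzag condition for the vertex `v`. -/
def Zigzag (G : Dgraph V) (H : Dgraph X) (v : V) (l : List X) : Prop :=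
  (TypeIN G v → INCompatible H l) ∧ (TypeOUT G v → OUTCompatible H l)

/-- A recoloring sequence: a nonempty sequence of homomorphisms in which
consecutive homomorphisms differ on exactly one vertex. -/
def IsRecolSeq (G : Dgraph V) (H : Dgraph X) (σs : List (V → X)) : Prop :=
  σs ≠ [] ∧ (∀ σ ∈ σs, IsHom G H σ) ∧ σs.Chain' fun σ σ' => ∃! u, σ u ≠ σ' u

/-- The monochromatic neighborhood property: whenever a vertex changes its
color, all of its neighbors (in the underlying undirected graph) have one
common color. -/
def MonoNbhd (G : Dgraph V) (σs : List (V → X)) : Prop :=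
  σs.Chain' fun σ σ' => ∀ v, σ v ≠ σ' v → ∃ h, ∀ w, G.UAdj v w → σ w = h

/-- `VWalk G v σs S`: `S` is the vertex walk `S(v)` of the recoloring sequence
`σs`; each color change of `v` from `a` to `b`, while all neighbors of `v` are
colored `h`, contributes the two edges `(a h)(h b)`. -/
inductive VWalk (G : Dgraph V) (v : V) : List (V → X) → List X → Prop
  | single (σ : V → X) : VWalk G v [σ] [σ v]
  | stay {σ σ' : V → X} {rest : List (V → X)} {l : List X} :
      σ v = σ' v → VWalk G v (σ' :: rest) l → VWalk G v (σ :: σ' :: rest) l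
  | move {σ σ' : V → X} {rest : List (V → X)} {l : List X} (h : X) :
      σ v ≠ σ' v → (∀ w, G.UAdj v w → σ w = h) →
      VWalk G v (σ' :: rest) l → VWalk G v (σ :: σ' :: rest) (σ v :: h :: l)

/-- `H`-realizability of a walk `Q` via recoloring sequences satisfying the
monochromatic neighborhood property: `Q = S(q)` in `π(H)`. -/
def MRealizable (G : Dgraph V) (H : Dgraph X) (α β : V → X) (q : V) (Q : List X) : Prop :=
  ∃ (σs : List (V → X)) (Sq : List X),
    IsRecolSeq G H σs ∧ σs.head? = some α ∧ σs.getLast? = some β ∧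
    MonoNbhd G σs ∧ VWalk G q σs Sq ∧ PiEq Sq Q

/-- Orientation compatibility of a walk `Q`: every generated vertex walk
satisfies the zigzag condition. -/
def OrientCompatible (G : Dgraph V) (H : Dgraph X) (α β : V → X) (q : V) (Q : List X) : Prop :=
  ∀ (v : V) (Wl : List V), IsWalk G q v Wl →
    ∀ S : List X, IsReduced S → PiEq (conj α β Wl Q) S → Zigzag G H v S

/-- Hom₁-adjacency: the homomorphisms differ on exactly one vertex and, for
every arc `x → y` of `G`, both `φ x → ψ y` and `ψ x → φ y` are arcs of `H`. -/
def Hom1Adj (G : Dgraph V) (H : Dgraph X) (φ ψ : V → X) : Prop :=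
  (∃! u, φ u ≠ ψ u) ∧ ∀ ⦃x y⦄, G.Adj x y → H.Adj (φ x) (ψ y) ∧ H.Adj (ψ x) (φ y)

/-- A recoloring sequence in the Hom₁ sense (digraphs). -/
def Hom1Seq (G : Dgraph V) (H : Dgraph X) (σs : List (V → X)) : Prop :=
  σs ≠ [] ∧ (∀ σ ∈ σs, IsHom G H σ) ∧ σs.Chain' (Hom1Adj G H)

/-- A recoloring sequence in which each step recolors exactly one vertex to an
adjacent color (the Hom₁ sense for reflexive undirected graphs). -/
def AdjRecolSeq (G : Dgraph V) (H : Dgraph X) (σs : List (V → X)) : Prop :=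
  σs ≠ [] ∧ (∀ σ ∈ σs, IsHom G H σ) ∧
  σs.Chain' fun σ σ' => (∃! u, σ u ≠ σ' u) ∧ ∀ u, σ u ≠ σ' u → H.Adj (σ u) (σ' u)

/-- The push-or-pull property: whenever a vertex changes its color from `a` to
`b`, every neighbor of that vertex has color `a` or `b`. -/
def PushOrPull (G : Dgraph V) (σs : List (V → X)) : Prop :=
  σs.Chain' fun σ σ' => ∀ u, σ u ≠ σ' u → ∀ w, G.UAdj u w → σ w = σ u ∨ σ w = σ' u

/-- The walk of successive colors of `v` along a recoloring sequence. -/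
def colorWalk (σs : List (V → X)) (v : V) : List X := σs.map fun σ => σ v

/-- `H`-realizability via recoloring sequences (reflexive undirected Hom₁
sense) satisfying the push-or-pull property. -/
def PRealizable (G : Dgraph V) (H : Dgraph X) (α β : V → X) (q : V) (Q : List X) : Prop :=
  ∃ σs : List (V → X), AdjRecolSeq G H σs ∧ σs.head? = some α ∧ σs.getLast? = some β ∧
    PushOrPull G σs ∧ PiEq (colorWalk σs q) Q

/-- `H`-realizability via Hom₁ recoloring sequences of digraphs satisfying the
push-or-pull property. -/
def DRealizable (G : Dgraph V) (H : Dgraph X) (α β : V → X) (q : V) (Q : List X) : Prop :=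
  ∃ σs : List (V → X), Hom1Seq G H σs ∧ σs.head? = some α ∧ σs.getLast? = some β ∧
    PushOrPull G σs ∧ PiEq (colorWalk σs q) Q

/-- `H` contains no 4-cycle of algebraic girth 0 as a subgraph (neither of the
two orientations of the 4-cycle with two forward and two backward arcs). -/
def NoZeroGirthC4 (H : Dgraph X) : Prop :=
  ∀ a b c d : X, a ≠ b → a ≠ c → a ≠ d → b ≠ c → b ≠ d → c ≠ d →
    ¬(H.Adj a b ∧ H.Adj b d ∧ H.Adj a c ∧ H.Adj c d) ∧
    ¬(H.Adj a b ∧ H.Adj d b ∧ H.Adj a c ∧ H.Adj d c)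

/-- `H` contains no triangle of algebraic girth 1 as a subgraph. -/
def NoOneGirthTriangle (H : Dgraph X) : Prop :=
  ∀ x y z : X, x ≠ y → y ≠ z → x ≠ z → ¬(H.Adj x y ∧ H.Adj y z ∧ H.Adj x z)

/-- A path in the reconfiguration graph `R_H(G)` from `α` to `β`. -/
def IsRPath (G : Dgraph V) (H : Dgraph X) (α β : V → X) (L : List (V → X)) : Prop :=
  L ≠ [] ∧ L.head? = some α ∧ L.getLast? = some β ∧
  (∀ σ ∈ L, IsHom G H σ) ∧ L.Chain' fun φ ψ => ∃! u, φ u ≠ ψ u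

/-- A path in the graph `Hom₁(G, H)` from `α` to `β`. -/
def IsHom1Path (G : Dgraph V) (H : Dgraph X) (α β : V → X) (L : List (V → X)) : Prop :=
  L ≠ [] ∧ L.head? = some α ∧ L.getLast? = some β ∧
  (∀ σ ∈ L, IsHom G H σ) ∧ L.Chain' (Hom1Adj G H)

/-- The set of reduced walks `Q` from `α q` to `β q` that generate symmetric
vertex walks on `V'` with the system of walks `Wf`. -/
def SymGenSet (H : Dgraph X) (α β : V → X) (q : V)
    (V' : Set V) (Wf : V → List V) : Set (List X) :=
  {Q | IsWalk H (α q) (β q) Q ∧ IsReduced Q ∧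
    ∀ v ∈ V', ∀ S : List X, IsReduced S → PiEq (conj α β (Wf v) Q) S → IsSymWalk H S}

/-- The set of orientation-compatible walks for `q` and the system `Uf`. -/
def OCSet (G : Dgraph V) (H : Dgraph X) (α β : V → X) (q : V)
    (Uf : V → List V) : Set (List X) :=
  {Q | IsWalk H (α q) (β q) Q ∧ IsReduced Q ∧ Even (wlen Q) ∧
    ∀ (v : V) (S : List X), IsReduced S → PiEq (conj α β (Uf v) Q) S → Zigzag G H v S}

/-- The set `Π_q` of walks from `α q` to `β q` that are `H`-realizable via
recoloring sequences satisfying the monochromatic neighborhood property. -/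
def MRealSet (G : Dgraph V) (H : Dgraph X) (α β : V → X) (q : V) : Set (List X) :=
  {Q | IsWalk H (α q) (β q) Q ∧ IsReduced Q ∧ MRealizable G H α β q Q}

/-- The set of walks from `α q` to `β q` that are `H`-realizable via
recoloring sequences satisfying the push-or-pull property. -/
def PRealSet (G : Dgraph V) (H : Dgraph X) (α β : V → X) (q : V) : Set (List X) :=
  {Q | IsWalk H (α q) (β q) Q ∧ IsReduced Q ∧ PRealizable G H α β q Q}

/-- Ceiling division on natural numbers. -/
def cdiv (a b : ℕ) : ℕ := (a + b - 1) / b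

end HRecoloring

open HRecoloring

namespace HRecoloring

variable {V X Y : Type}

theorem RStep.append_append {l l' : List X} (h : RStep l l') (p s : List X) :
    RStep (p ++ l ++ s) (p ++ l' ++ s) := by
  rcases h with ⟨p', s', x, y, rfl, rfl⟩ | ⟨p', s', x, rfl, rfl⟩
  · exact Or.inl ⟨p ++ p', s' ++ s, x, y, by simp, by simp⟩
  · exact Or.inr ⟨p ++ p', s' ++ s, x, by simp, by simp⟩

theorem RStep.map {l l' : List X} (h : RStep l l') (f : X → Y) :
    RStep (l.map f) (l'.map f) := by
  rcases h with ⟨p, s, x, y, rfl, rfl⟩ | ⟨p, s, x, rfl, rfl⟩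
  · exact Or.inl ⟨p.map f, s.map f, f x, f y, by simp, by simp⟩
  · exact Or.inr ⟨p.map f, s.map f, f x, by simp, by simp⟩

theorem RStep.reverse {l l' : List X} (h : RStep l l') : RStep l.reverse l'.reverse := by
  rcases h with ⟨p, s, x, y, rfl, rfl⟩ | ⟨p, s, x, rfl, rfl⟩
  · exact Or.inl ⟨s.reverse, p.reverse, x, y, by simp, by simp⟩
  · exact Or.inr ⟨s.reverse, p.reverse, x, by simp, by simp⟩

theorem RStep.head?_eq {l l' : List X} (h : RStep l l') : l.head? = l'.head? := by
  rcases h with ⟨p, s, x, y, rfl, rfl⟩ | ⟨p, s, x, rfl, rfl⟩ <;> cases p <;> simp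

theorem PiEq.refl (l : List X) : PiEq l l := Relation.EqvGen.refl l

theorem PiEq.symm {l l' : List X} (h : PiEq l l') : PiEq l' l := Relation.EqvGen.symm _ _ h

theorem PiEq.trans {l l' l'' : List X} (h : PiEq l l') (h' : PiEq l' l'') : PiEq l l'' :=
  Relation.EqvGen.trans _ _ _ h h'

theorem PiEq.lift {f : List X → List Y} (hf : ∀ l l', RStep l l' → RStep (f l) (f l'))
    {l l' : List X} (h : PiEq l l') : PiEq (f l) (f l') := by
  induction h with
  | rel _ _ h => exact .rel _ _ (hf _ _ h)
  | refl => exact .refl _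
  | symm _ _ _ ih => exact ih.symm
  | trans _ _ _ _ _ ih ih' => exact ih.trans ih'

theorem PiEq.eq_of_invariant {f : List X → Y} (hf : ∀ l l', RStep l l' → f l = f l')
    {l l' : List X} (h : PiEq l l') : f l = f l' := by
  induction h with
  | rel _ _ h => exact hf _ _ h
  | refl => rfl
  | symm _ _ _ ih => exact ih.symm
  | trans _ _ _ _ _ ih ih' => exact ih.trans ih'

theorem PiEq.append_append {l l' : List X} (h : PiEq l l') (p s : List X) :
    PiEq (p ++ l ++ s) (p ++ l' ++ s) :=
  h.lift (f := fun l => p ++ l ++ s) fun _ _ h => h.append_append p s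

theorem PiEq.map {l l' : List X} (h : PiEq l l') (f : X → Y) : PiEq (l.map f) (l'.map f) :=
  h.lift fun _ _ h => h.map f

theorem PiEq.reverse {l l' : List X} (h : PiEq l l') : PiEq l.reverse l'.reverse :=
  h.lift fun _ _ h => h.reverse

theorem PiEq.head?_eq {l l' : List X} (h : PiEq l l') : l.head? = l'.head? :=
  h.eq_of_invariant fun _ _ h => h.head?_eq

theorem PiEq.getLast?_eq {l l' : List X} (h : PiEq l l') : l.getLast? = l'.getLast? := by
  simpa using h.reverse.head?_eq

theorem wcomp_eq_dropLast_append {l₁ l₂ : List X} {x : X} (h₁ : l₁.getLast? = some x)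
    (h₂ : l₂.head? = some x) : wcomp l₁ l₂ = l₁.dropLast ++ l₂ := by
  obtain ⟨p, rfl⟩ := List.getLast?_eq_some_iff.1 h₁
  obtain ⟨s, rfl⟩ := List.head?_eq_some_iff.1 h₂
  simp [wcomp]

theorem head?_wcomp {l₁ l₂ : List X} {x : X} (h : l₁.head? = some x) :
    (wcomp l₁ l₂).head? = some x := by
  simp [wcomp, h]

theorem getLast?_wcomp {l₁ l₂ : List X} {x y : X} (h₁ : l₁.getLast? = some x)
    (h₂ : l₂.head? = some x) (h : l₂.getLast? = some y) :
    (wcomp l₁ l₂).getLast? = some y := by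
  rw [wcomp_eq_dropLast_append h₁ h₂]
  simp [h]

theorem wcomp_assoc (l₁ : List X) {l₂ : List X} (l₃ : List X) (h : l₂ ≠ []) :
    wcomp (wcomp l₁ l₂) l₃ = wcomp l₁ (wcomp l₂ l₃) := by
  cases l₂ with
  | nil => exact absurd rfl h
  | cons => simp [wcomp]

theorem PiEq.wcomp {l₁ l₁' l₂ l₂' : List X} {x : X} (h₁ : PiEq l₁ l₁') (h₂ : PiEq l₂ l₂')
    (hx₁ : l₁.getLast? = some x) (hx₂ : l₂.head? = some x) :
    PiEq (wcomp l₁ l₂) (wcomp l₁' l₂') := by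
  have hleft : PiEq (HRecoloring.wcomp l₁ l₂) (HRecoloring.wcomp l₁' l₂) := by
    simpa [HRecoloring.wcomp] using h₁.append_append [] l₂.tail
  have hx₁' : l₁'.getLast? = some x := h₁.getLast?_eq ▸ hx₁
  refine hleft.trans ?_
  rw [wcomp_eq_dropLast_append hx₁' hx₂, wcomp_eq_dropLast_append hx₁' (h₂.head?_eq ▸ hx₂)]
  simpa using h₂.append_append l₁'.dropLast []

theorem PiEq.wcomp_reverse_self {l : List X} {x : X} (h : l.head? = some x) :
    PiEq (HRecoloring.wcomp l l.reverse) [x] := by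
  obtain ⟨t, rfl⟩ := List.head?_eq_some_iff.1 h
  clear h
  induction t generalizing x with
  | nil => exact .refl _
  | cons y t ih =>
    have h := (ih (x := y)).append_append [x] [x]
    have e : HRecoloring.wcomp (x :: y :: t) (x :: y :: t).reverse =
        [x] ++ HRecoloring.wcomp (y :: t) (y :: t).reverse ++ [x] := by
      have hne : (y :: t).reverse ≠ [] := by simp
      rw [HRecoloring.wcomp, List.reverse_cons, List.tail_append_of_ne_nil hne]
      simp [HRecoloring.wcomp]
    rw [e]
    exact h.trans (.rel _ _ (Or.inl ⟨[], [], x, y, by simp, by simp⟩))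

theorem PiEq.reverse_wcomp_self {l : List X} {x : X} (h : l.getLast? = some x) :
    PiEq (HRecoloring.wcomp l.reverse l) [x] := by
  simpa using PiEq.wcomp_reverse_self (l := l.reverse) (x := x) (by simpa using h)

theorem wcomp_singleton (l : List X) (x : X) : wcomp l [x] = l := by simp [wcomp]

theorem singleton_wcomp {l : List X} {x : X} (h : l.head? = some x) : wcomp [x] l = l := by
  obtain ⟨s, rfl⟩ := List.head?_eq_some_iff.1 h
  simp [wcomp]

theorem ne_nil_of_head? {l : List X} {x : X} (h : l.head? = some x) : l ≠ [] := by
  rintro rfl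
  simp at h

theorem conj_congr {α β : V → X} {W W' : List V} {Q Q' : List X} {q : V}
    (hW : PiEq W W') (hQ : PiEq Q Q') (hq : W.head? = some q)
    (hQh : Q.head? = some (α q)) (hQl : Q.getLast? = some (β q)) :
    PiEq (conj α β W Q) (conj α β W' Q') := by
  have hr : (W.map α).reverse.getLast? = some (α q) := by simp [hq]
  refine PiEq.wcomp ((hW.map α).reverse.wcomp hQ hr hQh) (hW.map β)
    (x := β q) (getLast?_wcomp hr hQh hQl) (by simp [hq])

theorem conj_wcomp (α β : V → X) {W D : List V} (Q : List X) {v : V}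
    (hW : W.getLast? = some v) (hD : D.head? = some v) :
    conj α β (wcomp W D) Q = conj α β D (conj α β W Q) := by
  obtain ⟨p, rfl⟩ := List.getLast?_eq_some_iff.1 hW
  obtain ⟨s, rfl⟩ := List.head?_eq_some_iff.1 hD
  cases p <;> simp [conj, wcomp]

theorem conj_concat (α β : V → X) {W : List V} (Q : List X) (v : V) (hW : W ≠ []) :
    conj α β (W ++ [v]) Q = [α v] ++ conj α β W Q ++ [β v] := by
  cases W with
  | nil => exact absurd rfl hW
  | cons => simp [conj, wcomp]

theorem head?_conj {α β : V → X} {W : List V} {Q : List X} {v : V}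
    (hW : W.getLast? = some v) : (conj α β W Q).head? = some (α v) :=
  head?_wcomp (head?_wcomp (by simp [hW]))

theorem getLast?_conj {α β : V → X} {W : List V} {Q : List X} {q v : V}
    (hq : W.head? = some q) (hv : W.getLast? = some v)
    (hQh : Q.head? = some (α q)) (hQl : Q.getLast? = some (β q)) :
    (conj α β W Q).getLast? = some (β v) :=
  getLast?_wcomp (x := β q) (getLast?_wcomp (x := α q) (by simp [hq]) hQh hQl)
    (by simp [hq]) (by simp [hv])

theorem Dgraph.UAdj.symm {G : Dgraph V} {u v : V} (h : G.UAdj u v) : G.UAdj v u := Or.symm h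

theorem IsWalk.reverse {G : Dgraph V} {a b : V} {l : List V} (h : IsWalk G a b l) :
    IsWalk G b a l.reverse := by
  obtain ⟨h₁, h₂, h₃, h₄⟩ := h
  refine ⟨by simpa using h₁, by simpa using h₃, by simpa using h₂, ?_⟩
  exact List.isChain_reverse.2 (h₄.imp fun _ _ h => h.symm)

theorem IsWalk.wcomp {G : Dgraph V} {a b c : V} {l₁ l₂ : List V} (h₁ : IsWalk G a b l₁)
    (h₂ : IsWalk G b c l₂) : IsWalk G a c (wcomp l₁ l₂) := by
  refine ⟨ne_nil_of_head? (head?_wcomp h₁.2.1), head?_wcomp h₁.2.1,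
    getLast?_wcomp h₁.2.2.1 h₂.2.1 h₂.2.2.1, ?_⟩
  obtain ⟨-, -, hl, hc₁⟩ := h₁
  obtain ⟨-, hh, -, hc₂⟩ := h₂
  obtain ⟨p, rfl⟩ := List.getLast?_eq_some_iff.1 hl
  obtain ⟨s, rfl⟩ := List.head?_eq_some_iff.1 hh
  have hc : (p ++ b :: s).IsChain G.UAdj := List.isChain_split.2 ⟨hc₁, hc₂⟩
  rw [wcomp_eq_dropLast_append (by simp) (x := b) (by simp), List.dropLast_concat]
  exact hc

theorem IsWalk.map {G : Dgraph V} {H : Dgraph X} {f : V → X} (hf : IsHom G H f) {a b : V}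
    {l : List V} (h : IsWalk G a b l) : IsWalk H (f a) (f b) (l.map f) := by
  obtain ⟨h₁, h₂, h₃, h₄⟩ := h
  refine ⟨by simpa using h₁, by simp [h₂], by simp [h₃], ?_⟩
  exact (List.isChain_map f).2 (h₄.imp fun _ _ h => h.imp (@hf _ _) (@hf _ _))

theorem IsWalk.conj {G : Dgraph V} {H : Dgraph X} {α β : V → X} (hα : IsHom G H α)
    (hβ : IsHom G H β) {q v : V} {W : List V} {Q : List X} (hW : IsWalk G q v W)
    (hQ : IsWalk H (α q) (β q) Q) : IsWalk H (α v) (β v) (conj α β W Q) :=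
  ((hW.map hα).reverse.wcomp hQ).wcomp (hW.map hβ)

/-- Conjugation by a closed walk fixes a topologically valid walk. -/
theorem TopValid.conj_closed {G : Dgraph V} {H : Dgraph X} {α β : V → X} {q : V} {Q : List X}
    (h : TopValid G H α β q Q) (hQh : Q.head? = some (α q)) (hQl : Q.getLast? = some (β q))
    {C : List V} (hC : IsWalk G q q C) : PiEq (conj α β C Q) Q := by
  obtain ⟨hne, hh, hl, -⟩ := id hC
  have hAne : C.map α ≠ [] := by simpa using hne
  have hQne : Q ≠ [] := ne_nil_of_head? hQh
  set A := C.map α with hA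
  have hAh : A.head? = some (α q) := by simp [hA, hh]
  have hAl : A.getLast? = some (α q) := by simp [hA, hl]
  have hRl : A.reverse.getLast? = some (α q) := by simp [hAh]
  have hAQl : (wcomp A.reverse Q).getLast? = some (β q) := getLast?_wcomp hRl hQh hQl
  have h₁ : PiEq (conj α β C Q)
      (wcomp (wcomp A.reverse Q) (wcomp (wcomp Q.reverse A) Q)) :=
    (PiEq.refl _).wcomp (h C hC) hAQl (by simp [hh])
  have e : wcomp (wcomp A.reverse Q) (wcomp (wcomp Q.reverse A) Q) =
      wcomp A.reverse (wcomp (wcomp Q Q.reverse) (wcomp A Q)) := by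
    rw [wcomp_assoc _ _ hQne, wcomp_assoc Q.reverse _ hAne,
      wcomp_assoc Q _ (by simpa using hQne)]
  rw [e] at h₁
  have hAQh : (wcomp A Q).head? = some (α q) := head?_wcomp hAh
  have h₂ : PiEq (wcomp (wcomp Q Q.reverse) (wcomp A Q)) (wcomp A Q) := by
    have := (PiEq.wcomp_reverse_self hQh).wcomp (PiEq.refl (wcomp A Q)) (x := α q)
      (getLast?_wcomp hQl (by simp [hQl]) (by simp [hQh])) hAQh
    rwa [singleton_wcomp hAQh] at this
  have h₃ := (PiEq.refl A.reverse).wcomp h₂ hRl (head?_wcomp (head?_wcomp hQh))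
  rw [← wcomp_assoc A.reverse Q hAne] at h₃
  have h₄ := (PiEq.reverse_wcomp_self hAl).wcomp (PiEq.refl Q)
    (getLast?_wcomp hRl hAh hAl) hQh
  rw [singleton_wcomp hQh] at h₄
  exact h₁.trans (h₃.trans h₄)

/-- The walk generated at `v` does not depend on the chosen walk from `q` to `v`. -/
theorem TopValid.conj_piEq_conj {G : Dgraph V} {H : Dgraph X} {α β : V → X} {q v : V}
    {Q : List X} (h : TopValid G H α β q Q) (hQh : Q.head? = some (α q))
    (hQl : Q.getLast? = some (β q)) {W W' : List V} (hW : IsWalk G q v W)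
    (hW' : IsWalk G q v W') : PiEq (conj α β W Q) (conj α β W' Q) := by
  have hC := hW.wcomp hW'.reverse
  have h₁ : PiEq (wcomp (wcomp W W'.reverse) W') W := by
    rw [wcomp_assoc _ _ hW'.reverse.1]
    have := (PiEq.refl W).wcomp (PiEq.reverse_wcomp_self hW'.2.2.1) hW.2.2.1
      (head?_wcomp hW'.reverse.2.1)
    rwa [wcomp_singleton] at this
  refine (conj_congr h₁.symm (.refl Q) hW.2.1 hQh hQl).trans ?_
  rw [conj_wcomp α β Q hC.2.2.1 hW'.2.1]
  exact conj_congr (.refl W') (h.conj_closed hQh hQl hC) hW'.2.1 (head?_conj hC.2.2.1)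
    (getLast?_conj hC.2.1 hC.2.2.1 hQh hQl)

section NormalForm

open Classical in
/-- Prepend a vertex to a reduced walk, cancelling a backtracking pair or a loop step. -/
noncomputable def push : X → List X → List X
  | x, [] => [x]
  | x, [y] => if x = y then [y] else [x, y]
  | x, y :: z :: t =>
    if x = y then y :: z :: t else if x = z then z :: t else x :: y :: z :: t

/-- The reduced walk equal to a given walk in the fundamental groupoid. -/
noncomputable def normalForm (l : List X) : List X := l.foldr push []

theorem normalForm_cons (x : X) (l : List X) : normalForm (x :: l) = push x (normalForm l) := rfl

theorem IsReduced.of_cons {x : X} {l : List X} (h : IsReduced (x :: l)) : IsReduced l := by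
  intro l' hl
  exact h (x :: l') (by simpa using hl.append_append [x] [])

theorem IsReduced.ne {x y : X} {l : List X} (h : IsReduced (x :: y :: l)) : x ≠ y := by
  rintro rfl
  exact h (x :: l) (Or.inr ⟨[], l, x, by simp, by simp⟩)

theorem IsReduced.ne' {x y z : X} {l : List X} (h : IsReduced (x :: y :: z :: l)) : x ≠ z := by
  rintro rfl
  exact h (x :: l) (Or.inl ⟨[], l, x, y, by simp, by simp⟩)

theorem IsReduced.cons {x : X} {l : List X} (h : IsReduced l)
    (h₁ : ∀ y t, l = y :: t → x ≠ y) (h₂ : ∀ y z t, l = y :: z :: t → x ≠ z) :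
    IsReduced (x :: l) := by
  rintro l' (⟨p, s, a, b, e, -⟩ | ⟨p, s, a, e, -⟩) <;> cases p with
  | nil => simp at e; grind
  | cons c p =>
    simp only [List.cons_append, List.cons.injEq] at e
    first
    | exact h _ (Or.inl ⟨p, s, a, b, e.2, rfl⟩)
    | exact h _ (Or.inr ⟨p, s, a, e.2, rfl⟩)

theorem isReduced_nil : IsReduced ([] : List X) := by
  rintro l' (⟨p, s, a, b, e, -⟩ | ⟨p, s, a, e, -⟩) <;> simp at e

theorem isReduced_push (x : X) {l : List X} (h : IsReduced l) : IsReduced (push x l) := by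
  fun_cases push x l with
  | case1 => exact h.cons (by simp) (by simp)
  | case2 => exact h
  | case3 => exact h.cons (by grind) (by grind)
  | case4 => exact h
  | case5 => exact h.of_cons
  | case6 => exact h.cons (by grind) (by grind)

theorem isReduced_normalForm (l : List X) : IsReduced (normalForm l) := by
  induction l with
  | nil => exact isReduced_nil
  | cons x l ih => exact isReduced_push x ih

theorem push_eq_cons {x : X} {l : List X} (h : IsReduced (x :: l)) : push x l = x :: l := by
  match l, h with
  | [], _ => rfl
  | [y], h => simp [push, h.ne]
  | y :: z :: t, h => simp [push, h.ne, h.ne']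

theorem IsReduced.normalForm_eq {l : List X} (h : IsReduced l) : normalForm l = l := by
  induction l with
  | nil => rfl
  | cons x l ih => rw [normalForm_cons, ih h.of_cons, push_eq_cons h]

theorem head?_push (x : X) (l : List X) : (push x l).head? = some x := by
  fun_cases push x l <;> simp_all

theorem push_cons_self (x : X) (l : List X) : push x (x :: l) = x :: l := by
  cases l <;> simp [push]

theorem push_push_self (x : X) (l : List X) : push x (push x l) = push x l := by
  obtain ⟨m, hm⟩ := List.head?_eq_some_iff.1 (head?_push x l)
  rw [hm, push_cons_self]

theorem push_push_push {l : List X} (h : IsReduced l) (x y : X) :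
    push x (push y (push x l)) = push x l := by
  have hr := isReduced_push x h
  obtain ⟨m, hm⟩ := List.head?_eq_some_iff.1 (head?_push x l)
  rw [hm] at hr ⊢
  by_cases hyx : y = x
  · rw [hyx, push_cons_self, push_cons_self]
  cases m with
  | nil => simp [push, hyx, Ne.symm hyx]
  | cons z t =>
    by_cases hyz : y = z
    · subst hyz
      simpa [push, hyx] using push_eq_cons hr
    · simp [push, hyx, hyz, Ne.symm hyx]

theorem RStep.normalForm_eq {l l' : List X} (h : RStep l l') : normalForm l = normalForm l' := by
  rcases h with ⟨p, s, x, y, rfl, rfl⟩ | ⟨p, s, x, rfl, rfl⟩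
  · have := push_push_push (isReduced_normalForm s) x y
    simp only [normalForm] at this
    simp [normalForm, this]
  · simp [normalForm, push_push_self]

theorem PiEq.normalForm_eq {l l' : List X} (h : PiEq l l') : normalForm l = normalForm l' :=
  h.eq_of_invariant fun _ _ h => h.normalForm_eq

theorem head?_normalForm (l : List X) : (normalForm l).head? = l.head? := by
  cases l with
  | nil => rfl
  | cons x l => simp [normalForm_cons, head?_push]

theorem length_normalForm_mod_two {l : List X} (h : l.IsChain (· ≠ ·)) :
    (normalForm l).length % 2 = l.length % 2 := by
  induction l with
  | nil => rfl
  | cons x l ih =>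
    have ih := ih h.tail
    have hh := head?_normalForm l
    rw [normalForm_cons]
    have hx : ∀ y, l.head? = some y → x ≠ y := by
      intro y hy
      obtain ⟨s, rfl⟩ := List.head?_eq_some_iff.1 hy
      exact h.rel
    rw [← hh] at hx
    simp only [List.length_cons]
    generalize normalForm l = m at *
    fun_cases push x m <;> simp_all only [List.length_cons, List.length_nil] <;> grind

end NormalForm

section Alternating

/-- Consecutive entries of a list are related by `R`, by its converse, by `R` again, etc. -/
def Alternating : (X → X → Prop) → List X → Prop
  | _, [] => True
  | _, [_] => True
  | R, x :: y :: t => R x y ∧ Alternating (flip R) (y :: t)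

theorem alternating_iff (R : X → X → Prop) (l : List X) :
    Alternating R l ↔ ∀ (i : ℕ) (h : i + 1 < l.length),
      if i % 2 = 0 then R l[i] l[i + 1] else R l[i + 1] l[i] := by
  induction l generalizing R with
  | nil => simp [Alternating]
  | cons x l ih =>
    cases l with
    | nil => simp [Alternating]
    | cons y t =>
      rw [Alternating, ih]
      constructor
      · rintro ⟨h₀, h⟩ i hi
        cases i with
        | zero => simpa using h₀
        | succ i =>
          have := h i (by simpa using hi)
          rcases Nat.mod_two_eq_zero_or_one i with hm | hm
          · rw [if_pos hm] at this
            rw [if_neg (by omega)]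
            exact this
          · rw [if_neg (by omega)] at this
            rw [if_pos (by omega)]
            exact this
      · intro h
        refine ⟨by simpa using h 0 (by simp), fun i hi => ?_⟩
        have := h (i + 1) (by simpa using hi)
        rcases Nat.mod_two_eq_zero_or_one i with hm | hm
        · rw [if_pos hm]
          rw [if_neg (by omega)] at this
          exact this
        · rw [if_neg (by omega)]
          rw [if_pos (by omega)] at this
          exact this

theorem outCompatible_iff {H : Dgraph X} {l : List X} :
    OUTCompatible H l ↔ Alternating H.Adj l :=
  (alternating_iff _ _).symm

theorem inCompatible_iff {H : Dgraph X} {l : List X} :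
    INCompatible H l ↔ Alternating (flip H.Adj) l :=
  (alternating_iff (flip H.Adj) l).symm

theorem Alternating.cons {R : X → X → Prop} {l : List X} {a b : X} (h : Alternating R l)
    (ha : l.head? = some a) (hb : R a b) : Alternating (flip R) (b :: l) := by
  obtain ⟨s, rfl⟩ := List.head?_eq_some_iff.1 ha
  exact ⟨hb, h⟩

theorem Alternating.concat {R : X → X → Prop} {l : List X} {a b : X} (h : Alternating R l)
    (hl : l.length % 2 = 1) (ha : l.getLast? = some a) (hb : R a b) :
    Alternating R (l ++ [b]) := by
  match l, h with
  | [], _ => simp at ha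
  | [x], _ =>
    obtain rfl : x = a := by simpa using ha
    exact ⟨hb, trivial⟩
  | [x, y], _ => simp at hl
  | x :: y :: z :: t, h =>
    exact ⟨h.1, h.2.1, Alternating.concat (l := z :: t) h.2.2
      (by simp only [List.length_cons] at hl ⊢; omega) (by simpa using ha) hb⟩

theorem Alternating.push {R : X → X → Prop} (hR : ∀ x, ¬ R x x) {x : X} {l : List X}
    (h : Alternating (flip R) l) (hx : ∀ y, l.head? = some y → R x y) :
    Alternating R (push x l) := by
  fun_cases HRecoloring.push x l with
  | case1 => trivial
  | case2 => trivial
  | case3 => exact ⟨hx _ rfl, trivial⟩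
  | case4 => exact absurd (hx _ rfl) (hR _)
  | case5 => exact h.2
  | case6 => exact ⟨hx _ rfl, h⟩

theorem Alternating.normalForm {R : X → X → Prop} (hR : ∀ x, ¬ R x x) {l : List X}
    (h : Alternating R l) : Alternating R (normalForm l) := by
  induction l generalizing R with
  | nil => trivial
  | cons x l ih =>
    rw [normalForm_cons]
    cases l with
    | nil => trivial
    | cons y t =>
      refine (ih (R := flip R) hR h.2).push hR fun z hz => ?_
      rw [head?_normalForm] at hz
      obtain rfl : y = z := by simpa using hz
      exact h.1

end Alternating

theorem length_conj_mod_two (α β : V → X) {W : List V} {Q : List X} (hW : W ≠ [])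
    (hQ : Q ≠ []) (hQeven : Even (wlen Q)) : (conj α β W Q).length % 2 = 1 := by
  have h₁ := List.length_pos_iff.2 hW
  have h₂ := List.length_pos_iff.2 hQ
  rw [wlen, Nat.even_iff] at hQeven
  simp only [conj, wcomp, List.length_append, List.length_reverse, List.length_map,
    List.length_tail]
  omega

theorem IsWalk.isChain_ne {H : Dgraph X} (hH : H.Loopless) {a b : X} {l : List X}
    (h : IsWalk H a b l) : l.IsChain (· ≠ ·) :=
  h.2.2.2.imp fun x y hxy e => by
    subst e
    exact hH x (or_self_iff.1 hxy)

theorem IsWalk.induction {G : Dgraph V} {P : V → Prop}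
    (hP : ∀ u v, G.UAdj u v → P u → P v) {a b : V} {l : List V} (h : IsWalk G a b l)
    (ha : P a) : P b := by
  obtain ⟨-, hh, hl, hc⟩ := h
  induction l generalizing a with
  | nil => simp at hh
  | cons x l ih =>
    obtain rfl : x = a := by simpa using hh
    cases l with
    | nil =>
      obtain rfl : x = b := by simpa using hl
      exact ha
    | cons y t => exact ih (hP x y hc.rel ha) rfl (by simpa using hl) hc.tail

end HRecoloring

/-- Propagation of the zigzag condition: (1) if `G` has no vertex of type SYM
and `Q` satisfies the zigzag condition for `q`, then every generated vertex
walk `S_v` satisfies the zigzag condition for `v`; (2) if the vertices of type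
SYM form a nonempty set and their vertex walks satisfy the zigzag condition,
then every vertex walk `S_v` satisfies the zigzag condition for `v`. -/
theorem statement8 {V X : Type} [Fintype V] [Fintype X]
    (G : Dgraph V) (H : Dgraph X)
    (hGll : G.Loopless) (hHll : H.Loopless)
    (hGconn : G.WConn) (hHconn : H.WConn)
    (α β : V → X) (hα : IsHom G H α) (hβ : IsHom G H β)
    (q : V) (Q : List X) (hQ : IsWalk H (α q) (β q) Q)
    (hQred : IsReduced Q) (hQeven : Even (wlen Q))
    (hQtv : TopValid G H α β q Q)
    (Wf : V → List V) (hWf : ∀ v, IsWalk G q v (Wf v))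
    (S : V → List X) (hSred : ∀ v, IsReduced (S v))
    (hSpi : ∀ v, PiEq (conj α β (Wf v) Q) (S v)) :
    ((¬ ∃ v, TypeSYM G v) → Zigzag G H q Q → ∀ v, Zigzag G H v (S v)) ∧
    ((∃ v, TypeSYM G v) → (∀ w, TypeSYM G w → Zigzag G H w (S w)) →
      ∀ v, Zigzag G H v (S v)) := by
  have hstep : ∀ u v, G.UAdj u v →
      PiEq ([α v] ++ S u ++ [β v]) (S v) := by
    intro u v huv
    have hWv : IsWalk G q v (Wf u ++ [v]) := by
      have : IsWalk G u v [u, v] := ⟨by simp, rfl, rfl, List.isChain_pair.2 huv⟩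
      exact (hWf u).wcomp this
    have h := hQtv.conj_piEq_conj hQ.2.1 hQ.2.2.1 hWv (hWf v)
    rw [conj_concat α β Q v (hWf u).1] at h
    exact ((hSpi u).symm.append_append _ _).trans (h.trans (hSpi v))
  have hhead : ∀ u, (S u).head? = some (α u) := fun u =>
    (hSpi u).head?_eq ▸ head?_conj (hWf u).2.2.1
  have hlast : ∀ u, (S u).getLast? = some (β u) := fun u =>
    (hSpi u).getLast?_eq ▸ getLast?_conj (hWf u).2.1 (hWf u).2.2.1 hQ.2.1 hQ.2.2.1
  have hodd : ∀ u, (S u).length % 2 = 1 := by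
    intro u
    rw [← (hSred u).normalForm_eq, ← (hSpi u).normalForm_eq,
      length_normalForm_mod_two (((hWf u).conj hα hβ hQ).isChain_ne hHll)]
    exact length_conj_mod_two α β (hWf u).1 hQ.1 hQeven
  have halt : ∀ (R : X → X → Prop), (∀ x, ¬ R x x) → ∀ u v, G.UAdj u v →
      R (α u) (α v) → R (β u) (β v) → Alternating R (S u) → Alternating (flip R) (S v) := by
    intro R hR u v huv ha hb h
    have h' : Alternating (flip R) (α v :: (S u ++ [β v])) :=
      (h.concat (hodd u) (hlast u) hb).cons (by simp [hhead u]) ha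
    rw [← (hSred v).normalForm_eq, ← (hstep u v huv).normalForm_eq]
    exact h'.normalForm (R := flip R) hR
  have hprop : ∀ u v, G.UAdj u v → ¬ TypeSYM G v → Zigzag G H u (S u) → Zigzag G H v (S v) := by
    intro u v huv hv hz
    rcases id huv with h | h
    · refine ⟨fun _ => ?_, fun ho => absurd ⟨⟨u, h⟩, ho⟩ hv⟩
      exact inCompatible_iff.2 (halt H.Adj hHll u v huv (hα h) (hβ h)
        (outCompatible_iff.1 (hz.2 ⟨v, h⟩)))
    · refine ⟨fun hi => absurd ⟨hi, ⟨u, h⟩⟩ hv, fun _ => ?_⟩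
      exact outCompatible_iff.2 (halt (flip H.Adj) hHll u v huv (hα h) (hβ h)
        (inCompatible_iff.1 (hz.1 ⟨v, h⟩)))
  constructor
  · intro hns hz v
    have hSq : S q = Q := by
      rw [← (hSred q).normalForm_eq, ← (hSpi q).normalForm_eq,
        (hQtv.conj_closed hQ.2.1 hQ.2.2.1 (hWf q)).normalForm_eq, hQred.normalForm_eq]
    exact (hWf v).induction (P := fun v => Zigzag G H v (S v))
      (fun u v huv => hprop u v huv fun h => hns ⟨v, h⟩) (hSq.symm ▸ hz)
  · rintro ⟨w, hw⟩ hsym v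
    obtain ⟨l, hl⟩ := hGconn w v
    refine hl.induction (P := fun v => Zigzag G H v (S v)) (fun u v huv hz => ?_) (hsym w hw)
    by_cases hv : TypeSYM G v
    · exact hsym v hv
    · exact hprop u v huv hv hz
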